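/- Let A be a finite set with |A| = a, let S be a finite index set, and for each s ∈ S let f_s : A × A → A be a quasigroup operation on A. Let m ≥ 1, let Z be an A-valued random variable uniformly distributed on A, and let W = (W_1,…,W_{m-1}) be an A^{m-1}-valued random vector uniformly distributed on A^{m-1} (each value has probability 1/a^{m-1}), with Z and W independent. For j = 1,…,m-1 let σ_j : A^j → S be arbitrary functions, and define V_1 = Z and V_{j+1} = f_{σ_j(V_1,…,V_j)}(V_j, W_j) for j = 1,…,m-1. Then the random vector (V_1,…,V_m) is uniformly distributed on A^m, i.e., every value in A^m is attained with probability 1/a^m. -/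

import Mathlib

open MeasureTheory ProbabilityTheory

/-- A binary operation `f` on `A` is a quasigroup operation if for all `u, v`
the equations `f x u = v` and `f u y = v` each have a unique solution,
i.e. all left and right translations are bijections. -/
def IsQuasigroup {A : Type*} (f : A → A → A) : Prop :=
  (∀ u : A, Function.Bijective (fun y => f u y)) ∧
  (∀ u : A, Function.Bijective (fun x => f x u))

/-- Let `A` be finite with `|A| = a`, `S` a finite index set and
`f s` a quasigroup operation on `A` for each `s ∈ S`. Let `m ≥ 1`, let `Z` be
uniform on `A`, let `W = (W₁,…,W_{m-1})` be uniform on `A^{m-1}`, with `Z` and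
`W` independent. For arbitrary selection functions `σ_j : A^j → S` define
`V₁ = Z` and `V_{j+1} = f_{σ_j(V₁,…,V_j)}(V_j, W_j)` (indexed from `0` here).
Then the random vector `(V₁,…,V_m)` is uniformly distributed on `A^m`:
every value is attained with probability `1 / a^m`. -/
theorem PE_round_tuple_uniform {Ω A S : Type*} [MeasurableSpace Ω]
    [Fintype A] [Nonempty A] [MeasurableSpace A] [MeasurableSingletonClass A]
    [Fintype S]
    (μ : Measure Ω) [IsProbabilityMeasure μ]
    (f : S → A → A → A) (hq : ∀ s : S, IsQuasigroup (f s))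
    (m : ℕ) (hm : 1 ≤ m)
    (Z : Ω → A) (W : Ω → (Fin (m - 1) → A))
    (hZ : Measurable Z) (hW : Measurable W)
    (hZW : IndepFun Z W μ)
    (hZunif : ∀ i : A, μ {ω | Z ω = i} = 1 / (Fintype.card A : ENNReal))
    (hWunif : ∀ w : Fin (m - 1) → A,
      μ {ω | W ω = w} = 1 / (Fintype.card A : ENNReal) ^ (m - 1))
    (σ : ∀ j : ℕ, (Fin (j + 1) → A) → S)
    (V : Fin m → Ω → A)
    (hV0 : ∀ h0 : 0 < m, V ⟨0, h0⟩ = Z)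
    (hVs : ∀ (j : ℕ) (h : j + 1 < m),
      V ⟨j + 1, h⟩ = fun ω =>
        f (σ j (fun i : Fin (j + 1) => V ⟨i, i.2.trans h⟩ ω))
          (V ⟨j, Nat.lt_of_succ_lt h⟩ ω) (W ω ⟨j, by omega⟩)) :
    ∀ v : Fin m → A,
      μ {ω | (fun t : Fin m => V t ω) = v} = 1 / (Fintype.card A : ENNReal) ^ m := by
  intro v
  have hm0 : 0 < m := hm
  choose w hw using fun j : Fin (m - 1) =>
    ((hq (σ j fun i : Fin (j + 1) => v ⟨i, by omega⟩)).1 (v ⟨j, by omega⟩)).2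
      (v ⟨j + 1, by omega⟩)
  have hset : {ω | (fun t : Fin m => V t ω) = v} = Z ⁻¹' {v ⟨0, hm0⟩} ∩ W ⁻¹' {w} := by
    ext ω
    simp only [Set.mem_ofPred_eq, Set.mem_inter_iff, Set.mem_preimage, Set.mem_singleton_iff]
    constructor
    · intro hv
      have hv' : ∀ t, V t ω = v t := fun t => congrFun hv t
      refine ⟨by rw [← hV0 hm0, hv'], funext fun j => ?_⟩
      have hstep := congrFun (hVs j (by omega)) ω
      simp only [hv'] at hstep
      exact ((hq _).1 _).1 (hstep.symm.trans (hw j).symm)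
    · rintro ⟨hz, hW'⟩
      have key : ∀ n (hn : n < m), V ⟨n, hn⟩ ω = v ⟨n, hn⟩ := by
        intro n
        induction n using Nat.strong_induction_on with
        | _ n ih =>
          intro hn
          cases n with
          | zero => rw [hV0 hn, hz]
          | succ j =>
            have hprefix : (fun i : Fin (j + 1) => V ⟨i, i.2.trans hn⟩ ω) =
                fun i : Fin (j + 1) => v ⟨i, i.2.trans hn⟩ :=
              funext fun i => ih i i.2 _
            refine (congrFun (hVs j hn) ω).trans ?_
            rw [hprefix, ih j j.lt_succ_self, hW']
            exact hw ⟨j, by omega⟩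
      exact funext fun t => key t t.2
  have hZv : μ (Z ⁻¹' {v ⟨0, hm0⟩}) = 1 / (Fintype.card A : ENNReal) := hZunif _
  have hWw : μ (W ⁻¹' {w}) = 1 / (Fintype.card A : ENNReal) ^ (m - 1) := hWunif w
  rw [hset, hZW.measure_inter_preimage_eq_mul _ _ (measurableSet_singleton _)
    (measurableSet_singleton _), hZv, hWw]
  simp only [one_div, ENNReal.inv_pow]
  rw [← pow_succ', Nat.sub_add_cancel hm]
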